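/- There exist a constant c > 0 and a positive integer M such that for every integer a ≥ M there is a lucky number l with a² < l < (a + c·log a)². -/

import Mathlib

open scoped BigOperators

namespace LuckyPaper

/-- Rank of `k` in `A`: the number of elements of `A` that are `≤ k`
(the 1-indexed position of `k` in `A` when `k ∈ A`). -/
noncomputable def rank (A : Set ℕ) (k : ℕ) : ℕ := Set.ncard {m | m ∈ A ∧ m ≤ k}

/-- One sieve step: delete every `d`-th element of `A` (listed in increasing order). -/
noncomputable def step (A : Set ℕ) (d : ℕ) : Set ℕ := {k | k ∈ A ∧ ¬ d ∣ rank A k}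

/-- The lucky sieve: `sieve i = (A_i, l_i)`, where `A_0 = {1,2,3,…}`, `l_0 = 1` (dummy),
`l_{i+1}` is the smallest element of `A_i` larger than `l_i`, and `A_{i+1}` is obtained
from `A_i` by deleting every `l_{i+1}`-th element.  In particular `l_1 = 2`. -/
noncomputable def sieve : ℕ → Set ℕ × ℕ
  | 0 => ({n | 1 ≤ n}, 1)
  | i + 1 =>
      let p := sieve i
      let d := sInf {m | m ∈ p.1 ∧ p.2 < m}
      (step p.1 d, d)

/-- `A i` : the set of survivors after `i` steps of the lucky sieve. -/
noncomputable def A (i : ℕ) : Set ℕ := (sieve i).1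

/-- `l i` : the `i`-th sieve parameter (`l 1 = 2`, `l 2 = 3`, `l 3 = 7`, `l 4 = 9`, …);
with this convention `l n` is the `n`-th lucky number for `n ≥ 2`. -/
noncomputable def l (i : ℕ) : ℕ := (sieve i).2

/-- The set of lucky numbers `A_∞ = ⋂ i, A i = {1, 3, 7, 9, 13, 15, 21, 25, …}`. -/
noncomputable def LuckySet : Set ℕ := ⋂ i, A i

/-- `L x` : the number of lucky numbers that are `≤ x`. -/
noncomputable def L (x : ℝ) : ℕ := Set.ncard {m | m ∈ LuckySet ∧ (m : ℝ) ≤ x}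

/-- `R i x = #{k ∈ A_{i-1} : k ≤ x}`. -/
noncomputable def R (i : ℕ) (x : ℝ) : ℕ := Set.ncard {m | m ∈ A (i - 1) ∧ (m : ℝ) ≤ x}

/-- `𝕃 = {l 1, l 2, l 3, …} = {2, 3, 7, 9, 13, …}`. -/
noncomputable def Ell : Set ℕ := {a | ∃ i, 1 ≤ i ∧ l i = a}

/-- `starIdx i m` : the `m`-th number deleted at step `i` of the sieve, i.e. the
`(l i * m)`-th smallest element of `A (i-1)` (`Nat.nth` is 0-indexed). -/
noncomputable def starIdx (i m : ℕ) : ℕ := Nat.nth (· ∈ A (i - 1)) (l i * m - 1)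

/-- The binary operation `*` : for `a ∈ 𝕃`, `star a m = a * m` is the `m`-th number
deleted at the (unique) step `i ≥ 1` with `l i = a`. -/
noncomputable def star (a m : ℕ) : ℕ := starIdx (sInf {i | 1 ≤ i ∧ l i = a}) m

/-- `evalStar [a₁, …, a_k] = a₁ * (a₂ * (⋯ * a_k)⋯)`. -/
noncomputable def evalStar : List ℕ → ℕ
  | [] => 1
  | [a] => a
  | a :: b :: rest => star a (evalStar (b :: rest))

/-- `t = (a₁, …, a_k)` is a lucky factorization of `n` : `k ≥ 1`, `a_j ∈ 𝕃` for `j < k`,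
`a_k` is a lucky number (possibly 1), and `n = a₁*(a₂*(⋯*a_k)⋯)`. -/
def IsLuckyFactorization (n : ℕ) (t : List ℕ) : Prop :=
  t ≠ [] ∧ (∀ a ∈ t.dropLast, a ∈ Ell) ∧ t.getLast! ∈ LuckySet ∧ evalStar t = n

/-- The canonical tuple of `n` given by the fundamental theorem of arithmetic
for lucky numbers. -/
noncomputable def canonicalTuple (n : ℕ) : List ℕ :=
  haveI := Classical.propDecidable (∃ t, IsLuckyFactorization n t)
  if h : ∃ t, IsLuckyFactorization n t then h.choose else []

/-- `Ω°(n)` : the length of the canonical tuple of `n`. -/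
noncomputable def bigOmega (n : ℕ) : ℕ := (canonicalTuple n).length

/-- `ω°(n)` : the number of distinct entries of the canonical tuple of `n`. -/
noncomputable def smallOmega (n : ℕ) : ℕ := (canonicalTuple n).dedup.length

/-- `d°(n)` : the number of distinct nonempty contiguous subtuples (infixes) of the
canonical tuple of `n`. -/
noncomputable def dCirc (n : ℕ) : ℕ :=
  Set.ncard {s : List ℕ | s ≠ [] ∧ s <:+: canonicalTuple n}

/-- `B` : positive integers whose canonical tuple has last entry `≠ 1`. -/
noncomputable def Bset : Set ℕ := {n | 1 ≤ n ∧ (canonicalTuple n).getLast! ≠ 1}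

/-- `C` : positive integers whose canonical tuple ends with the pair `(2, 1)`. -/
noncomputable def Cset : Set ℕ := {n | 1 ≤ n ∧ ∃ t, canonicalTuple n = t ++ [2, 1]}

/-- `S = B ∪ C`. -/
noncomputable def Sset : Set ℕ := Bset ∪ Cset

/-- The `𝕃`-tuple of `a ∈ S` : the canonical tuple of `a` if it does not end in `1`,
else the canonical tuple with the final `1` removed (so it ends in `2`). -/
noncomputable def ellTuple (a : ℕ) : List ℕ :=
  if (canonicalTuple a).getLast! = 1 then (canonicalTuple a).dropLast else canonicalTuple a

/-- The extended operation `∘` : if the `𝕃`-tuple of `a` is `(t₁, …, t_k)`, then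
`a ∘ b = t₁*(t₂*(⋯*(t_k*b)⋯))`. -/
noncomputable def circ (a b : ℕ) : ℕ := (ellTuple a).foldr star b


/-! ### Counting in the sieve -/

theorem rank_succ (S : Set ℕ) (k : ℕ) [Decidable (k + 1 ∈ S)] :
    rank S (k + 1) = rank S k + if k + 1 ∈ S then 1 else 0 := by
  have hfin : {m | m ∈ S ∧ m ≤ k}.Finite := (Set.finite_Iic k).subset fun m hm => hm.2
  unfold rank
  split_ifs with h
  · have : {m | m ∈ S ∧ m ≤ k + 1} = insert (k + 1) {m | m ∈ S ∧ m ≤ k} := by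
      ext m
      simp only [Set.mem_ofPred_eq, Set.mem_insert_iff]
      constructor
      · rintro ⟨h1, h2⟩
        by_cases hm : m = k + 1
        · exact Or.inl hm
        · exact Or.inr ⟨h1, by omega⟩
      · rintro (rfl | ⟨h1, h2⟩)
        · exact ⟨h, le_rfl⟩
        · exact ⟨h1, by omega⟩
    rw [this, Set.ncard_insert_of_notMem (by simp) hfin]
  · congr 1
    ext m
    simp only [Set.mem_ofPred_eq]
    constructor
    · rintro ⟨h1, h2⟩
      refine ⟨h1, ?_⟩
      by_contra hm
      exact h ((show m = k + 1 by omega) ▸ h1)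
    · rintro ⟨h1, h2⟩
      exact ⟨h1, by omega⟩

theorem rank_zero {S : Set ℕ} (h0 : 0 ∉ S) : rank S 0 = 0 := by
  have : {m | m ∈ S ∧ m ≤ 0} = ∅ := by
    ext m
    simp only [Set.mem_ofPred_eq, nonpos_iff_eq_zero, Set.mem_empty_iff_false, iff_false]
    rintro ⟨h, rfl⟩
    exact h0 h
  rw [rank, this, Set.ncard_empty]

theorem rank_mono_right (S : Set ℕ) : Monotone (rank S) := by
  classical
  exact monotone_nat_of_le_succ fun k => by rw [rank_succ]; omega

theorem rank_mono_left {S T : Set ℕ} (h : S ⊆ T) (k : ℕ) : rank S k ≤ rank T k :=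
  Set.ncard_le_ncard (fun _ hm => ⟨h hm.1, hm.2⟩)
    ((Set.finite_Iic k).subset fun _ hm => hm.2)

theorem rank_le {S : Set ℕ} (h0 : 0 ∉ S) (k : ℕ) : rank S k ≤ k := by
  classical
  induction k with
  | zero => rw [rank_zero h0]
  | succ k ih => rw [rank_succ]; split_ifs <;> omega

theorem rank_pos {S : Set ℕ} {k : ℕ} (hk : k ∈ S) : 0 < rank S k :=
  (Set.ncard_pos ((Set.finite_Iic k).subset fun _ hm => hm.2)).2 ⟨k, hk, le_rfl⟩

theorem rank_eq_of_forall_notMem {S : Set ℕ} {j k : ℕ} (hjk : j ≤ k)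
    (h : ∀ m ∈ S, j < m → k < m) : rank S k = rank S j := by
  unfold rank
  congr 1
  ext m
  simp only [Set.mem_ofPred_eq, and_congr_right_iff]
  intro hm
  constructor
  · intro hmk
    by_contra hj
    exact absurd (h m hm (by omega)) (by omega)
  · intro hmj
    omega

theorem rank_step {S : Set ℕ} (h0 : 0 ∉ S) (d k : ℕ) :
    rank (step S d) k = rank S k - rank S k / d := by
  classical
  induction k with
  | zero => rw [rank_zero h0, rank_zero fun h => h0 h.1]; simp
  | succ k ih =>
    rw [rank_succ (step S d)]
    by_cases hk : k + 1 ∈ S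
    · have hr := rank_succ S k
      rw [if_pos hk] at hr
      have hle := Nat.div_le_self (rank S k) d
      by_cases hd : d ∣ rank S (k + 1)
      · rw [if_neg fun h => h.2 hd, ih, hr, Nat.succ_div, if_pos (hr ▸ hd)]
        omega
      · rw [if_pos ⟨hk, hd⟩, ih, hr, Nat.succ_div, if_neg (hr ▸ hd)]
        omega
    · have hr := rank_succ S k
      rw [if_neg hk, add_zero] at hr
      rw [if_neg fun h => hk h.1, ih, hr, add_zero]

theorem A_zero : A 0 = {n | 1 ≤ n} := rfl

theorem A_succ (i : ℕ) : A (i + 1) = step (A i) (l (i + 1)) := rfl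

theorem l_zero : l 0 = 1 := rfl

theorem l_succ (i : ℕ) : l (i + 1) = sInf {m | m ∈ A i ∧ l i < m} := rfl

theorem A_antitone : Antitone A := antitone_nat_of_succ_le fun i => by
  rw [A_succ]
  exact fun _ hk => hk.1

theorem zero_notMem_A (i : ℕ) : 0 ∉ A i := fun h =>
  absurd (A_antitone (Nat.zero_le i) h) (by simp [A_zero])

theorem rank_A_zero (k : ℕ) : rank (A 0) k = k := by
  classical
  induction k with
  | zero => exact rank_zero (zero_notMem_A 0)
  | succ k ih => rw [rank_succ, ih, if_pos (by simp [A_zero])]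

theorem rank_A_succ (i k : ℕ) :
    rank (A (i + 1)) k = rank (A i) k - rank (A i) k / l (i + 1) := by
  rw [A_succ, rank_step (zero_notMem_A i)]

theorem exists_mem_gt_of_rank_unbounded {S : Set ℕ} (h : ∀ N, ∃ k, N < rank S k) (j : ℕ) :
    ∃ m ∈ S, j < m := by
  by_contra! hS
  obtain ⟨k, hk⟩ := h (rank S j)
  have hjk : j ≤ k := by
    by_contra hkj
    exact absurd (rank_mono_right S (show k ≤ j by omega)) (by omega)
  have := rank_eq_of_forall_notMem hjk fun m hm hjm => absurd (hS m hm) (by omega)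
  omega

theorem rank_A_unbounded_and_lt_l (i : ℕ) : (∀ N, ∃ k, N < rank (A i) k) ∧ i < l i := by
  induction i with
  | zero => exact ⟨fun N => ⟨N + 1, by rw [rank_A_zero]; omega⟩, by rw [l_zero]; omega⟩
  | succ i ih =>
    obtain ⟨m, hm⟩ := exists_mem_gt_of_rank_unbounded ih.1 (l i)
    have hmem : l (i + 1) ∈ {m | m ∈ A i ∧ l i < m} := by
      rw [l_succ]
      exact Nat.sInf_mem ⟨m, hm⟩
    have hl : i + 1 < l (i + 1) := by have := hmem.2; omega
    refine ⟨fun N => ?_, hl⟩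
    obtain ⟨k, hk⟩ := ih.1 (2 * N + 1)
    refine ⟨k, ?_⟩
    rw [rank_A_succ]
    have : rank (A i) k / l (i + 1) ≤ rank (A i) k / 2 := Nat.div_le_div_left (by omega) (by omega)
    omega

theorem lt_l (i : ℕ) : i < l i := (rank_A_unbounded_and_lt_l i).2

theorem exists_mem_A_gt (i j : ℕ) : ∃ m ∈ A i, j < m :=
  exists_mem_gt_of_rank_unbounded (rank_A_unbounded_and_lt_l i).1 j

theorem l_succ_mem (i : ℕ) : l (i + 1) ∈ A i ∧ l i < l (i + 1) := by
  rw [l_succ]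
  exact Nat.sInf_mem (s := {m | m ∈ A i ∧ l i < m}) (exists_mem_A_gt i (l i))

theorem l_strictMono : StrictMono l := strictMono_nat_of_lt_succ fun i => (l_succ_mem i).2

theorem one_mem_A (i : ℕ) : 1 ∈ A i := by
  induction i with
  | zero => simp [A_zero]
  | succ i ih =>
    rw [A_succ]
    refine ⟨ih, fun h => ?_⟩
    have h1 := Nat.le_of_dvd (rank_pos ih) h
    have h2 := rank_le (zero_notMem_A i) 1
    have := lt_l (i + 1)
    omega

theorem mem_LuckySet_of_rank_lt {i k : ℕ} (hk : k ∈ A i) (hr : rank (A i) k < l (i + 1)) :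
    k ∈ LuckySet := by
  have h : ∀ j, i ≤ j → k ∈ A j := by
    intro j hj
    induction j, hj using Nat.le_induction with
    | base => exact hk
    | succ j hj ih =>
      rw [A_succ]
      refine ⟨ih, fun h => ?_⟩
      have h1 := Nat.le_of_dvd (rank_pos ih) h
      have h2 := rank_mono_left (A_antitone hj) k
      have h3 := l_strictMono.monotone (show i + 1 ≤ j + 1 by omega)
      omega
  refine Set.mem_iInter.2 fun j => ?_
  rcases le_total i j with hj | hj
  · exact h j hj
  · exact A_antitone hj hk

/-- Undoing a sieve step: the number of predecessors of a survivor before the step, in terms of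
the number of its predecessors after the step. -/
theorem rank_sub_one_eq {i k : ℕ} (hk : k ∈ A (i + 1)) :
    rank (A i) k - 1 =
      (rank (A (i + 1)) k - 1) + (rank (A (i + 1)) k - 1) / (l (i + 1) - 1) := by
  have hk' := hk
  rw [A_succ] at hk'
  have hnd := hk'.2
  have hl := lt_l (i + 1)
  rw [rank_A_succ]
  obtain ⟨d, hd⟩ : ∃ d, l (i + 1) = d + 1 := ⟨l (i + 1) - 1, by omega⟩
  rw [hd] at hnd ⊢
  set r := rank (A i) k
  obtain ⟨t, ht⟩ : ∃ t, r % (d + 1) = t + 1 :=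
    ⟨r % (d + 1) - 1, by have := Nat.pos_of_ne_zero (mt Nat.dvd_of_mod_eq_zero hnd); omega⟩
  have hlt := Nat.mod_lt r (show d + 1 > 0 by omega)
  have hdiv := Nat.div_add_mod r (d + 1)
  set q := r / (d + 1)
  have e1 : r - q - 1 = t + d * q := by
    have : (d + 1) * q = d * q + q := by ring
    omega
  have e2 : (t + d * q) / d = q := by
    rw [Nat.add_mul_div_left _ _ (by omega), Nat.div_eq_of_lt (by omega), zero_add]
  rw [Nat.add_sub_cancel, e1, e2]
  have : (d + 1) * q = d * q + q := by ring
  omega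

/-! ### Carrying a pair of positions back through the sieve -/

/-- A bound on `g` in terms of the quotients of `ρ` and `ρ + g` by `d`; it is stable under
undoing sieve steps as long as `g ≤ d`. -/
def GapControl (ρ g d : ℕ) : Prop :=
  ((ρ + g) / d = ρ / d ∧ g ≤ 2 * (ρ / d) + 1) ∨
    ((ρ + g) / d = ρ / d + 1 ∧
      2 * ((ρ + g) / d) * g ≤ (ρ + g) % d + 2 * ((ρ + g) / d) * (2 * (ρ / d) + 1))

theorem gapControl_of_le {ρ g d : ℕ} (hd : 0 < d) (hgd : g ≤ d) (hg : g ≤ 2 * (ρ / d) + 1) :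
    GapControl ρ g d := by
  have h1 : ρ / d ≤ (ρ + g) / d := Nat.div_le_div_right (by omega)
  have h2 : (ρ + g) / d ≤ ρ / d + 1 := by
    rw [← Nat.add_div_right _ hd]
    exact Nat.div_le_div_right (by omega)
  rcases (show (ρ + g) / d = ρ / d ∨ (ρ + g) / d = ρ / d + 1 by omega) with h | h
  · exact Or.inl ⟨h, hg⟩
  · exact Or.inr ⟨h, (Nat.mul_le_mul_left _ hg).trans (Nat.le_add_left _ _)⟩

theorem GapControl.le_of_carry {ρ g d : ℕ} (hd : 0 < d) (h : (ρ + g) / d = ρ / d + 1)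
    (hc : 2 * ((ρ + g) / d) * g ≤ (ρ + g) % d + 2 * ((ρ + g) / d) * (2 * (ρ / d) + 1)) :
    g ≤ 2 * (ρ / d + 1) := by
  have e1 := Nat.div_add_mod (ρ + g) d
  have e2 := Nat.div_add_mod ρ d
  have b2 := Nat.mod_lt ρ hd
  rw [h] at hc e1
  set q := ρ / d
  set a := (ρ + g) % d
  have ha : a < g := by
    have : d * (q + 1) = d * q + d := by ring
    omega
  by_contra hg
  nlinarith

theorem GapControl.le {ρ g d : ℕ} (hd : 0 < d) (h : GapControl ρ g d) :
    g ≤ 2 * ((ρ + g) / d) + 1 := by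
  rcases h with ⟨h, hg⟩ | ⟨h, hc⟩
  · omega
  · have := GapControl.le_of_carry hd h hc
    omega

theorem GapControl.undo {ρ g ρ' g' d d' : ℕ} (hd' : 0 < d') (hdd : d' < d)
    (hρ : ρ' = ρ + ρ / d) (hσ : ρ' + g' = (ρ + g) + (ρ + g) / d) (hg' : g' ≤ d')
    (h : GapControl ρ g d) : GapControl ρ' g' d' := by
  have hd : 0 < d := by omega
  have hqq : ρ / d ≤ ρ' / d' :=
    (Nat.div_le_div_right (Nat.le.intro hρ.symm)).trans (Nat.div_le_div_left hdd.le hd')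
  rcases h with ⟨h, hg⟩ | ⟨h, hc⟩
  · exact gapControl_of_le hd' hg' (by omega)
  · have hg2 := GapControl.le_of_carry hd h hc
    rcases hqq.lt_or_eq with hlt | heq
    · exact gapControl_of_le hd' hg' (by omega)
    · have e1 := Nat.div_add_mod (ρ + g) d
      obtain ⟨e, he⟩ : ∃ e, d = d' + 1 + e := ⟨d - d' - 1, by omega⟩
      have hp' : ρ' / d' + 1 ≤ (ρ' + g') / d' := by
        rw [Nat.le_div_iff_mul_le hd', ← heq, ← h, hσ]
        have : (ρ + g) / d * d' ≤ d * ((ρ + g) / d) := by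
          rw [mul_comm]; exact Nat.mul_le_mul_right _ hdd.le
        omega
      have hp'' : (ρ' + g') / d' ≤ ρ' / d' + 1 := by
        rw [← Nat.add_div_right _ hd']
        exact Nat.div_le_div_right (by omega)
      have hp : (ρ' + g') / d' = ρ' / d' + 1 := le_antisymm hp'' hp'
      refine Or.inr ⟨hp, ?_⟩
      have e1' := Nat.div_add_mod (ρ' + g') d'
      rw [hp, ← heq] at e1' ⊢
      rw [h] at e1 hc hσ
      set q := ρ / d
      set a := (ρ + g) % d
      set a' := (ρ' + g') % d'
      have hgg : g' = g + 1 := by omega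
      subst hgg
      have ha : a + 2 * (q + 1) ≤ a' := by
        subst he
        nlinarith [Nat.zero_le (e * (q + 1))]
      nlinarith

theorem gap_le_of_div_le {ρ g d a : ℕ} (hgd : g ≤ d) (hρ : ρ ≤ a ^ 2)
    (hg : g ≤ 2 * ((ρ + g) / d) + 1) : g ≤ 2 * a + 4 := by
  by_contra hlt
  have hp : 1 ≤ (ρ + g) / d := by omega
  have hm := Nat.mul_div_le (ρ + g) d
  set p := (ρ + g) / d
  have h1 : d ≤ ρ + g := le_trans (Nat.le_mul_of_pos_right d hp) hm
  have h2 : g * g ≤ d * (2 * p + 1) := Nat.mul_le_mul hgd hg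
  nlinarith

/-! ### The sieving factor -/

/-- `sieveFactor k` is the reciprocal of the density of `A k`. -/
noncomputable def sieveFactor (k : ℕ) : ℝ :=
  ∏ i ∈ Finset.range k, (l (i + 1) : ℝ) / ((l (i + 1) : ℝ) - 1)

theorem add_two_le_l_succ (i : ℕ) : (i : ℝ) + 2 ≤ l (i + 1) := by
  have := lt_l (i + 1)
  exact_mod_cast (show i + 2 ≤ l (i + 1) by omega)

theorem sieveFactor_zero : sieveFactor 0 = 1 := by simp [sieveFactor]

theorem sieveFactor_succ (k : ℕ) :
    sieveFactor (k + 1) = sieveFactor k * ((l (k + 1) : ℝ) / ((l (k + 1) : ℝ) - 1)) :=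
  Finset.prod_range_succ _ k

theorem one_le_factor (k : ℕ) : 1 ≤ (l (k + 1) : ℝ) / ((l (k + 1) : ℝ) - 1) := by
  have := add_two_le_l_succ k
  have hk : (0 : ℝ) ≤ k := k.cast_nonneg
  rw [le_div_iff₀ (by linarith)]
  linarith

theorem sieveFactor_pos (k : ℕ) : 0 < sieveFactor k :=
  Finset.prod_pos fun i _ => one_pos.trans_le (one_le_factor i)

theorem sieveFactor_le_succ (k : ℕ) : sieveFactor k ≤ sieveFactor (k + 1) := by
  rw [sieveFactor_succ]
  exact le_mul_of_one_le_right (sieveFactor_pos k).le (one_le_factor k)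

theorem sieveFactor_mul_le {j k : ℕ} (h : j ≤ k) :
    sieveFactor k * (j + 1) ≤ sieveFactor j * (k + 1) := by
  induction k, h using Nat.le_induction with
  | base => exact le_rfl
  | succ k hk ih =>
    have hl := add_two_le_l_succ k
    have hk0 : (0 : ℝ) ≤ k := k.cast_nonneg
    have hf : (l (k + 1) : ℝ) / ((l (k + 1) : ℝ) - 1) ≤ (k + 2) / (k + 1) := by
      rw [div_le_div_iff₀ (by linarith) (by linarith)]
      nlinarith
    rw [sieveFactor_succ]
    push_cast
    calc _ = (sieveFactor k * (j + 1)) * ((l (k + 1) : ℝ) / ((l (k + 1) : ℝ) - 1)) := by ring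
      _ ≤ (sieveFactor j * (k + 1)) * ((k + 2) / (k + 1)) := by
        refine mul_le_mul ih hf (zero_le_one.trans (one_le_factor k)) ?_
        have := (sieveFactor_pos j).le
        positivity
      _ = _ := by field_simp; ring

theorem sieveFactor_mul_rank_sub_le (i k : ℕ) :
    sieveFactor i * ((rank (A i) k : ℝ) - i) ≤ k := by
  induction i with
  | zero => simp [sieveFactor_zero, rank_A_zero]
  | succ i ih =>
    refine le_trans ?_ ih
    have hl := add_two_le_l_succ i
    have hi : (0 : ℝ) ≤ i := i.cast_nonneg
    have hl1 : (0 : ℝ) < (l (i + 1) : ℝ) - 1 := by linarith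
    have hr : (rank (A (i + 1)) k : ℝ) * l (i + 1) ≤
        (rank (A i) k + 1) * ((l (i + 1) : ℝ) - 1) := by
      have h1 := Nat.div_add_mod (rank (A i) k) (l (i + 1))
      have h2 := Nat.mod_lt (rank (A i) k) (show 0 < l (i + 1) by have := lt_l (i + 1); omega)
      have h3 : rank (A (i + 1)) k + rank (A i) k / l (i + 1) = rank (A i) k := by
        rw [rank_A_succ]
        exact Nat.sub_add_cancel (Nat.div_le_self _ _)
      set q := rank (A i) k / l (i + 1)
      set t := rank (A i) k % l (i + 1)
      have h1' : (l (i + 1) : ℝ) * q + t = rank (A i) k := by exact_mod_cast h1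
      have h2' : (t : ℝ) + 1 ≤ l (i + 1) := by exact_mod_cast h2
      have h3' : (rank (A (i + 1)) k : ℝ) + q = rank (A i) k := by exact_mod_cast h3
      nlinarith
    rw [sieveFactor_succ, mul_assoc]
    refine mul_le_mul_of_nonneg_left ?_ (sieveFactor_pos i).le
    rw [div_mul_eq_mul_div, div_le_iff₀ hl1]
    push_cast
    nlinarith

theorem sub_le_rank_l {i k : ℕ} (h : i ≤ k) : k - i ≤ rank (A i) (l k) := by
  classical
  induction k, h using Nat.le_induction with
  | base => omega
  | succ k hk ih =>
    obtain ⟨hmem, hlt⟩ := l_succ_mem k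
    obtain ⟨m, hm⟩ : ∃ m, l (k + 1) = m + 1 := ⟨l (k + 1) - 1, by omega⟩
    have h1 := rank_mono_right (A i) (show l k ≤ m by omega)
    rw [hm] at hmem ⊢
    rw [rank_succ, if_pos (A_antitone hk hmem)]
    omega

theorem mul_sieveFactor_le_l (k : ℕ) : (k : ℝ) * sieveFactor k ≤ 16 * l k := by
  have hl : (k : ℝ) + 1 ≤ l k := by exact_mod_cast lt_l k
  have hk : (0 : ℝ) ≤ k := k.cast_nonneg
  rcases lt_or_ge k 4 with h4 | h4
  · have h := sieveFactor_mul_le (Nat.zero_le k)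
    rw [sieveFactor_zero] at h
    norm_num at h
    have : (k : ℝ) ≤ 4 := by exact_mod_cast h4.le
    have := (sieveFactor_pos k).le
    nlinarith
  · set j := k / 4
    have hj1 : (k : ℝ) ≤ 8 * j := by exact_mod_cast (show k ≤ 8 * j by omega)
    have hj2 : (k : ℝ) + 1 ≤ 4 * (j + 1) := by exact_mod_cast (show k + 1 ≤ 4 * (j + 1) by omega)
    have h1 := sieveFactor_mul_le (show j ≤ k by omega)
    have h2 := sieveFactor_mul_rank_sub_le j (l k)
    have h3 : (2 * j : ℝ) + j ≤ rank (A j) (l k) := by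
      have := sub_le_rank_l (show j ≤ k by omega)
      exact_mod_cast (show 2 * j + j ≤ rank (A j) (l k) by omega)
    have hPj := sieveFactor_pos j
    have hPk := sieveFactor_pos k
    have h4 : sieveFactor k ≤ 4 * sieveFactor j := by
      have hj : (0 : ℝ) < j + 1 := by positivity
      refine le_of_mul_le_mul_right ?_ hj
      nlinarith
    have h5 : sieveFactor j * (2 * j) ≤ l k :=
      (mul_le_mul_of_nonneg_left (by linarith) hPj.le).trans h2
    calc (k : ℝ) * sieveFactor k ≤ (8 * j) * (4 * sieveFactor j) :=
          mul_le_mul hj1 h4 hPk.le (by positivity)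
      _ = 16 * (sieveFactor j * (2 * j)) := by ring
      _ ≤ 16 * l k := by linarith

theorem sieveFactor_le_harmonic (k : ℕ) : sieveFactor k ≤ 1 + 16 * (harmonic k : ℝ) := by
  induction k with
  | zero => simp [sieveFactor_zero]
  | succ k ih =>
    have hl := add_two_le_l_succ k
    have hk : (0 : ℝ) ≤ k := k.cast_nonneg
    have hl1 : (0 : ℝ) < (l (k + 1) : ℝ) - 1 := by linarith
    have h := mul_sieveFactor_le_l (k + 1)
    have e : sieveFactor (k + 1) - sieveFactor k = sieveFactor (k + 1) / l (k + 1) := by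
      rw [sieveFactor_succ]
      have : (l (k + 1) : ℝ) ≠ 0 := by linarith
      field_simp
      ring
    have hstep : sieveFactor (k + 1) / l (k + 1) ≤ 16 * ((k : ℝ) + 1)⁻¹ := by
      rw [div_le_iff₀ (by linarith), ← div_eq_mul_inv, div_mul_eq_mul_div,
        le_div_iff₀ (by positivity)]
      push_cast at h
      linarith
    rw [harmonic_succ]
    push_cast
    linarith

theorem sieveFactor_le_log (k : ℕ) : sieveFactor k ≤ 17 + 16 * Real.log k := by
  have h1 := sieveFactor_le_harmonic k
  have h2 := harmonic_le_one_add_log k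
  linarith

/-- Undoing the first `i` sieve steps expands a gap by at most `sieveFactor i`, up to rounding. -/
theorem gap_zero_le {ρ g : ℕ → ℕ} {n : ℕ}
    (hρ : ∀ i < n, ρ i = ρ (i + 1) + ρ (i + 1) / (l (i + 1) - 1))
    (hσ : ∀ i < n, ρ i + g i =
      (ρ (i + 1) + g (i + 1)) + (ρ (i + 1) + g (i + 1)) / (l (i + 1) - 1))
    {i : ℕ} (hi : i ≤ n) : (g 0 : ℝ) ≤ sieveFactor i * (g i + i) := by
  induction i with
  | zero => simp [sieveFactor_zero]
  | succ i ih =>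
    refine (ih (by omega)).trans ?_
    have hl := add_two_le_l_succ i
    have hi0 : (0 : ℝ) ≤ i := i.cast_nonneg
    have hl1 : (0 : ℝ) < (l (i + 1) : ℝ) - 1 := by linarith
    have hg : g i ≤ g (i + 1) + g (i + 1) / (l (i + 1) - 1) + 1 := by
      have h1 := hρ i (by omega)
      have h2 := hσ i (by omega)
      have h4 : (ρ (i + 1) + g (i + 1)) / (l (i + 1) - 1) ≤
          ρ (i + 1) / (l (i + 1) - 1) + g (i + 1) / (l (i + 1) - 1) + 1 := by
        rw [Nat.add_div (by have := lt_l (i + 1); omega)]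
        split_ifs <;> omega
      omega
    have hg' : (g i : ℝ) ≤ g (i + 1) * ((l (i + 1) : ℝ) / ((l (i + 1) : ℝ) - 1)) + 1 := by
      have h1 : ((g (i + 1) / (l (i + 1) - 1) : ℕ) : ℝ) ≤
          (g (i + 1) : ℝ) / ((l (i + 1) : ℝ) - 1) := by
        refine Nat.cast_div_le.trans (le_of_eq ?_)
        rw [Nat.cast_sub (by have := lt_l (i + 1); omega), Nat.cast_one]
      have h2 : (g i : ℝ) ≤ g (i + 1) + (g (i + 1) / (l (i + 1) - 1) : ℕ) + 1 := by
        exact_mod_cast hg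
      have h3 : (g (i + 1) : ℝ) * ((l (i + 1) : ℝ) / ((l (i + 1) : ℝ) - 1)) =
          g (i + 1) + g (i + 1) / ((l (i + 1) : ℝ) - 1) := by
        field_simp
        ring
      linarith
    have hf := one_le_factor i
    rw [sieveFactor_succ, mul_assoc]
    refine mul_le_mul_of_nonneg_left ?_ (sieveFactor_pos i).le
    push_cast
    nlinarith

/-- Undoing sieve steps until the gap exceeds the sieving parameter. -/
theorem exists_gap_le {ρ g : ℕ → ℕ} {n a : ℕ}
    (hρ : ∀ i < n, ρ i = ρ (i + 1) + ρ (i + 1) / (l (i + 1) - 1))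
    (hσ : ∀ i < n, ρ i + g i =
      (ρ (i + 1) + g (i + 1)) + (ρ (i + 1) + g (i + 1)) / (l (i + 1) - 1))
    (hg0 : 0 < g 0) (hgn : g n = 1) (hn : 0 < n) (ha : ρ 0 ≤ a ^ 2) :
    ∃ k ≤ n, k ≤ g k ∧ g k ≤ 2 * a + 5 := by
  have hlpos : ∀ i, 0 < i → 0 < l i - 1 := fun i hi => by have := lt_l i; omega
  have hmono : ∀ i ≤ n, ρ i ≤ ρ 0 := by
    intro i
    induction i with
    | zero => intro _; exact le_rfl
    | succ i ih =>
      intro hi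
      exact (Nat.le.intro (hρ i (by omega)).symm).trans (ih (by omega))
  set k := Nat.findGreatest (fun i => l i - 1 < g i) n
  have hk : l k - 1 < g k :=
    Nat.findGreatest_spec (P := fun i => l i - 1 < g i) (Nat.zero_le n) (by simpa [l_zero] using hg0)
  have hkn : k ≤ n := Nat.findGreatest_le n
  have hgt : ∀ i, k < i → i ≤ n → g i ≤ l i - 1 := fun i h1 h2 =>
    not_lt.1 (Nat.findGreatest_is_greatest (P := fun i => l i - 1 < g i) h1 h2)
  have hkn' : k < n := by
    refine lt_of_le_of_ne hkn fun h => ?_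
    rw [h, hgn] at hk
    have := lt_l n
    omega
  have hctl : ∀ i ≤ n, k < i → GapControl (ρ i) (g i) (l i - 1) := by
    intro i hi
    induction hi using Nat.decreasingInduction with
    | self =>
      intro h
      exact gapControl_of_le (hlpos n hn) (hgt n h le_rfl) (by omega)
    | of_succ i hi ih =>
      intro h
      refine GapControl.undo (hlpos i (by omega)) ?_ (hρ i hi) (hσ i hi) (hgt i h hi.le)
        (ih (by omega))
      have := (l_succ_mem i).2
      have := lt_l i
      omega
  have hd := hlpos (k + 1) (by omega)
  have hc := hctl (k + 1) hkn' (by omega)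
  have hbd := gap_le_of_div_le (hgt (k + 1) (by omega) hkn') ((hmono (k + 1) hkn').trans ha)
    (hc.le hd)
  have hstep : g k ≤ g (k + 1) + 1 := by
    have h1 := hρ k hkn'
    have h2 := hσ k hkn'
    rcases hc with ⟨h, -⟩ | ⟨h, -⟩ <;> omega
  refine ⟨k, hkn, ?_, by omega⟩
  have := lt_l k
  omega

theorem exists_lucky_gt_sq_le (a : ℕ) (ha : 0 < a) :
    ∃ n ∈ LuckySet, a ^ 2 < n ∧
      (n : ℝ) ≤ (a : ℝ) ^ 2 + (17 + 16 * Real.log (2 * a + 5)) * (4 * a + 10) := by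
  classical
  set N := a ^ 2 + 1
  obtain ⟨s, ⟨hsA, hsa⟩, hsmin⟩ : ∃ s, (s ∈ A N ∧ a ^ 2 < s) ∧
      ∀ m, m ∈ A N → a ^ 2 < m → s ≤ m :=
    ⟨Nat.find (exists_mem_A_gt N (a ^ 2)), Nat.find_spec (exists_mem_A_gt N (a ^ 2)),
      fun m h1 h2 => Nat.find_min' _ ⟨h1, h2⟩⟩
  have ha1 : 1 ≤ a ^ 2 := Nat.one_le_pow _ _ ha
  set r := Nat.findGreatest (· ∈ A N) (a ^ 2)
  have hrA : r ∈ A N := Nat.findGreatest_spec (P := (· ∈ A N)) ha1 (one_mem_A N)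
  have hra : r ≤ a ^ 2 := Nat.findGreatest_le _
  have hrmax : ∀ m, m ∈ A N → r < m → a ^ 2 < m := fun m h1 h2 => by
    by_contra h
    exact Nat.findGreatest_is_greatest h2 (not_lt.1 h) h1
  have hrs : rank (A N) s = rank (A N) r + 1 := by
    obtain ⟨t, rfl⟩ : ∃ t, s = t + 1 := ⟨s - 1, by omega⟩
    rw [rank_succ, if_pos hsA, rank_eq_of_forall_notMem (show r ≤ t by omega)]
    intro m hm hrm
    exact hsmin m hm (hrmax m hm hrm)
  have hsl : s ∈ LuckySet := by
    refine mem_LuckySet_of_rank_lt hsA ?_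
    have h1 := rank_le (zero_notMem_A N) r
    have h2 := lt_l (N + 1)
    omega
  refine ⟨s, hsl, hsa, ?_⟩
  have hle : ∀ i, rank (A i) r ≤ rank (A i) s := fun i => rank_mono_right _ (by omega)
  have hpos : ∀ i ≤ N, 0 < rank (A i) r := fun i hi => rank_pos (A_antitone hi hrA)
  set ρ : ℕ → ℕ := fun i => rank (A i) r - 1 with hρdef
  set g : ℕ → ℕ := fun i => rank (A i) s - rank (A i) r with hgdef
  have hadd : ∀ i ≤ N, ρ i + g i = rank (A i) s - 1 := fun i hi => by
    have h1 := hle i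
    have h2 := hpos i hi
    simp only [hρdef, hgdef]
    omega
  have hρ : ∀ i < N, ρ i = ρ (i + 1) + ρ (i + 1) / (l (i + 1) - 1) := fun i hi =>
    rank_sub_one_eq (A_antitone (show i + 1 ≤ N by omega) hrA)
  have hσ : ∀ i < N, ρ i + g i =
      (ρ (i + 1) + g (i + 1)) + (ρ (i + 1) + g (i + 1)) / (l (i + 1) - 1) := fun i hi => by
    rw [hadd i hi.le, hadd (i + 1) hi]
    exact rank_sub_one_eq (A_antitone (show i + 1 ≤ N by omega) hsA)
  have hg0 : g 0 = s - r := by simp only [hgdef, rank_A_zero]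
  have hρ0 : ρ 0 ≤ a ^ 2 := by simp only [hρdef, rank_A_zero]; omega
  obtain ⟨k, hkN, hkg, hga⟩ := exists_gap_le hρ hσ (by omega)
    (show rank (A N) s - rank (A N) r = 1 by omega) (Nat.succ_pos _) hρ0
  have hgap := gap_zero_le hρ hσ hkN
  have hkR : (k : ℝ) ≤ 2 * a + 5 := by exact_mod_cast hkg.trans hga
  have hgR : (g k : ℝ) ≤ 2 * a + 5 := by exact_mod_cast hga
  have hlog : Real.log k ≤ Real.log (2 * a + 5) := by
    rcases Nat.eq_zero_or_pos k with h0 | h0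
    · rw [h0, Nat.cast_zero, Real.log_zero]
      exact Real.log_nonneg (by linarith [(a.cast_nonneg : (0 : ℝ) ≤ a)])
    · exact Real.log_le_log (by exact_mod_cast h0) hkR
  have hP := sieveFactor_le_log k
  have hs : (s : ℝ) ≤ (a : ℝ) ^ 2 + g 0 := by
    exact_mod_cast (show s ≤ a ^ 2 + g 0 by omega)
  refine hs.trans (add_le_add_right (hgap.trans ?_) _)
  have := sieveFactor_pos k
  exact mul_le_mul (by linarith) (by linarith) (by positivity) (by linarith)

/-- there exist a constant `c > 0` and a positive integer `M` such that for
every integer `a ≥ M` there is a lucky number `l` with `a² < l < (a + c·log a)²`. -/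
theorem lucky_between_squares :
    ∃ c : ℝ, 0 < c ∧ ∃ M : ℕ, 0 < M ∧ ∀ a : ℕ, M ≤ a →
      ∃ n ∈ LuckySet, (a : ℝ) ^ 2 < (n : ℝ) ∧
        (n : ℝ) < ((a : ℝ) + c * Real.log (a : ℝ)) ^ 2 := by
  refine ⟨200, by norm_num, 5, by norm_num, fun a ha => ?_⟩
  obtain ⟨n, hn, hlt, hle⟩ := exists_lucky_gt_sq_le a (by omega)
  refine ⟨n, hn, by exact_mod_cast hlt, hle.trans_lt ?_⟩
  have haR : (5 : ℝ) ≤ a := by exact_mod_cast ha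
  have h1 : 1 ≤ Real.log a := by
    rw [Real.le_log_iff_exp_le (by linarith)]
    linarith [Real.exp_one_lt_d9]
  have h2 : Real.log (2 * a + 5) ≤ 2 * Real.log a := by
    rw [← Real.log_rpow (by linarith), Real.rpow_two]
    exact Real.log_le_log (by linarith) (by nlinarith)
  calc (a : ℝ) ^ 2 + (17 + 16 * Real.log (2 * a + 5)) * (4 * a + 10)
      ≤ (a : ℝ) ^ 2 + (49 * Real.log a) * (6 * a) := by
        gcongr <;> linarith
    _ < ((a : ℝ) + 200 * Real.log a) ^ 2 := by nlinarith

end LuckyPaper
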